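/- For integers 0 ≤ r ≤ s, the product of Schur functions s_{Λ^r} · s_{Λ^s} (equivalently, of elementary symmetric functions e_r · e_s) equals the sum over k = 0,…,r of s_{Λ^{r−k}+Λ^{s+k}}, where Λ^{r−k}+Λ^{s+k} is the two-column partition with columns of lengths s+k and r−k, i.e., the partition (2,…,2,1,…,1) with r−k twos followed by s−r+2k ones. -/

import Mathlib

open Finset MvPolynomial

/-- `hp l k` is the complete homogeneous symmetric polynomial `h_k` in `l` variables,
interpreted as `0` for negative `k` (and `h_0 = 1`). -/
noncomputable def hp (l : ℕ) (k : ℤ) : MvPolynomial (Fin l) ℤ :=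
  if 0 ≤ k then MvPolynomial.hsymm (Fin l) ℤ k.toNat else 0

/-- The Schur polynomial of a partition (given as a weakly decreasing `l`-tuple) in `l`
variables, defined by the Jacobi–Trudi determinant `s_A = det (h_{A i - i + j})`. -/
noncomputable def schur (l : ℕ) (A : Fin l → ℕ) : MvPolynomial (Fin l) ℤ :=
  Matrix.det (Matrix.of fun i j : Fin l => hp l ((A i : ℤ) + (j : ℕ) - (i : ℕ)))

/-- The Vandermonde alternant `a_δ = det (x_i ^ (l - 1 - j))`. -/
noncomputable def vdm (l : ℕ) : MvPolynomial (Fin l) ℤ :=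
  Matrix.det (Matrix.of fun i j : Fin l => (X i : MvPolynomial (Fin l) ℤ) ^ (l - 1 - (j : ℕ)))

/-- The multiplicity (coefficient) of the Schur polynomial `s_B` in the expansion of a
symmetric polynomial `P` in the basis of Schur polynomials of partitions of length at most
`l`: it equals the coefficient of the monomial `x ^ (B + δ)` in the alternating polynomial
`P * a_δ`, where `δ = (l-1, l-2, …, 0)`. -/
noncomputable def schurMult (l : ℕ) (B : Fin l → ℕ) (P : MvPolynomial (Fin l) ℤ) : ℤ :=
  MvPolynomial.coeff (Finsupp.equivFunOnFinite.symm fun i : Fin l => B i + (l - 1 - (i : ℕ)))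
    (P * vdm l)

/-- The Littlewood–Richardson coefficient `c^C_{A,B}` for partitions of length at most `l`,
as the multiplicity of `s_C` in `s_A * s_B` (this agrees with the structure constants of the
ring of symmetric functions in the Schur basis). -/
noncomputable def lrCoeff (l : ℕ) (A B C : Fin l → ℕ) : ℤ :=
  schurMult l C (schur l A * schur l B)

/-- Dominance: every partial sum of `A` is at least the corresponding partial sum of `B`. -/
def Dom (l : ℕ) (A B : Fin l → ℕ) : Prop :=
  ∀ r : ℕ, ∑ i ∈ Finset.univ.filter (fun i : Fin l => (i : ℕ) < r), B i ≤
    ∑ i ∈ Finset.univ.filter (fun i : Fin l => (i : ℕ) < r), A i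

/-- The Young diagram of `A` (0-based): boxes `(i, j)` with `j < A i`. -/
def YD (l : ℕ) (A : Fin l → ℕ) : Set (Fin l × ℕ) := {p | p.2 < A p.1}


theorem det_one_row {R : Type*} [CommRing R] (n : ℕ) (p : Fin (n + 1))
    (N : Matrix (Fin (n + 1)) (Fin (n + 1)) R)
    (h : ∀ (i : Fin n) (k : Fin (n + 1)), N i.succ k = if k = p.succAbove i then 1 else 0) :
    N.det = (-1) ^ (p : ℕ) * N 0 p := by
  rw [Matrix.det_succ_row_zero, Finset.sum_eq_single p]
  · have : N.submatrix Fin.succ p.succAbove = 1 := by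
      ext i k
      simp [h, Matrix.one_apply, eq_comm]
    rw [this]; simp
  · intro j _ hj
    obtain ⟨i, rfl⟩ := Fin.exists_succAbove_eq hj
    rw [Matrix.det_eq_zero_of_row_eq_zero i, mul_zero]
    intro k
    simp [h, Fin.succAbove_ne]
  · simp

theorem det_two_row {R : Type*} [CommRing R] (n : ℕ) (p j0 : Fin (n + 2)) (q q' : Fin (n + 1))
    (h1 : p.succAbove q = j0) (h2 : j0.succAbove q' = p)
    (h3 : ∀ i, p.succAbove (q.succAbove i) = j0.succAbove (q'.succAbove i))
    (N : Matrix (Fin (n + 2)) (Fin (n + 2)) R)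
    (h : ∀ (i : Fin n) (k : Fin (n + 2)),
      N i.succ.succ k = if k = p.succAbove (q.succAbove i) then 1 else 0) :
    N.det = (-1) ^ (p : ℕ) * N 0 p * ((-1) ^ (q : ℕ) * N 1 j0) +
      (-1) ^ (j0 : ℕ) * N 0 j0 * ((-1) ^ (q' : ℕ) * N 1 p) := by
  have hne : p ≠ j0 := by rw [← h1]; exact (Fin.succAbove_ne _ _).symm
  have hz : ∀ j, j ≠ p → j ≠ j0 → (N.submatrix Fin.succ j.succAbove).det = 0 := by
    intro j hj hj'
    obtain ⟨t, rfl⟩ := Fin.exists_succAbove_eq hj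
    have ht : t ≠ q := by rintro rfl; exact hj' h1
    obtain ⟨i, rfl⟩ := Fin.exists_succAbove_eq ht
    apply Matrix.det_eq_zero_of_row_eq_zero i.succ
    intro k
    simp [h, Fin.succAbove_ne]
  rw [Matrix.det_succ_row_zero, ← Finset.sum_subset (Finset.subset_univ {p, j0}),
    Finset.sum_pair hne]
  · rw [det_one_row n q (N.submatrix Fin.succ p.succAbove),
      det_one_row n q' (N.submatrix Fin.succ j0.succAbove)]
    · simp [h1, h2]
    · intro i k
      simp [h, h3]
    · intro i k
      simp [h]
  · intro j _ hj
    simp only [Finset.mem_insert, Finset.mem_singleton, not_or] at hj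
    rw [hz j hj.1 hj.2, mul_zero]

noncomputable def gps (l : ℕ) : PowerSeries (MvPolynomial (Fin l) ℤ) :=
  PowerSeries.invOfUnit (PowerSeries.mk fun n => MvPolynomial.hsymm (Fin l) ℤ n) 1

noncomputable def gc (l k : ℕ) : MvPolynomial (Fin l) ℤ := PowerSeries.coeff k (gps l)

noncomputable def FF (l : ℕ) (c : ℤ) (k : ℕ) : MvPolynomial (Fin l) ℤ :=
  ∑ j ∈ Finset.range (k + 1), hp l (c + j) * gc l (k - j)

theorem hp_zero (l : ℕ) : hp l 0 = 1 := by simp [hp]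

theorem hp_neg (l : ℕ) (c : ℤ) (hc : c < 0) : hp l c = 0 := by
  simp [hp, hc]

theorem FF_zero (l k : ℕ) : FF l 0 k = if k = 0 then 1 else 0 := by
  have h : (PowerSeries.mk fun n => MvPolynomial.hsymm (Fin l) ℤ n) * gps l = 1 :=
    PowerSeries.mul_invOfUnit _ _ (by simp)
  have h2 := congrArg (PowerSeries.coeff k) h
  rw [PowerSeries.coeff_mul, Finset.Nat.sum_antidiagonal_eq_sum_range_succ_mk,
    PowerSeries.coeff_one] at h2
  rw [← h2, FF]
  apply Finset.sum_congr rfl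
  intro j _
  simp [hp, gc]

theorem FF_succ (l : ℕ) (c : ℤ) (k : ℕ) :
    FF l c (k + 1) = FF l (c + 1) k + hp l c * gc l (k + 1) := by
  rw [FF, Finset.sum_range_succ', FF]
  congr 1
  · apply Finset.sum_congr rfl
    intro j _
    rw [Nat.add_sub_add_right]
    congr 2
    push_cast; ring
  · simp

theorem gc_zero (l : ℕ) : gc l 0 = 1 := by
  have := FF_zero l 0
  simpa [FF, hp_zero] using this

theorem FF_neg (l m : ℕ) : ∀ k : ℕ, FF l (-(m : ℤ)) k = if k = m then 1 else 0 := by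
  induction m with
  | zero => intro k; simpa using FF_zero l k
  | succ m ih =>
    intro k
    cases k with
    | zero => simp [FF, hp_neg l (-1 + -(m : ℤ)) (by omega), hp_neg l (-(m : ℤ) - 1) (by omega),
        hp_neg l (-((m : ℤ) + 1)) (by omega)]
    | succ k =>
      rw [FF_succ, hp_neg _ _ (by omega)]
      have : (-((m + 1 : ℕ) : ℤ) + 1) = -(m : ℤ) := by push_cast; ring
      rw [this, ih]
      simp

theorem FF_one (l k : ℕ) : FF l 1 k = - gc l (k + 1) := by
  have h := FF_succ l 0 k
  rw [FF_zero, hp_zero] at h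
  simp only [Nat.succ_ne_zero, if_false, zero_add, one_mul] at h
  exact eq_neg_of_add_eq_zero_left h.symm

theorem FF_two (l k : ℕ) : FF l 2 k = - gc l (k + 2) - hp l 1 * gc l (k + 1) := by
  have h := FF_succ l 1 k
  rw [FF_one] at h
  norm_num at h
  rw [h]; ring

theorem hp_one (l : ℕ) : hp l 1 = - gc l 1 := by
  have := FF_one l 0
  simpa [FF, gc_zero] using this

theorem schur_FF (l : ℕ) (A : Fin l → ℕ) :
    schur l A = (Matrix.of fun i k : Fin l => FF l ((A i : ℤ) - (i : ℕ)) k).det := by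
  set E : Matrix (Fin l) (Fin l) (MvPolynomial (Fin l) ℤ) :=
    Matrix.of fun j k => if (j : ℕ) ≤ k then gc l (k - j) else 0 with hE
  have hdet : E.det = 1 := by
    rw [Matrix.det_of_isUpperTriangular]
    · simp [hE, gc_zero]
    · intro i j hij
      have : (j : ℕ) < i := hij
      simp [hE, Nat.not_le.2 this, -Fin.val_fin_le]
  rw [schur, ← mul_one (Matrix.det _), ← hdet, ← Matrix.det_mul]
  congr 1
  ext1 i k
  rw [Matrix.mul_apply]
  simp only [hE, Matrix.of_apply, FF]
  rw [Fin.sum_univ_eq_sum_range (fun j : ℕ => hp l ((A i : ℤ) + (j : ℕ) - (i : ℕ)) *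
    (if j ≤ (k : ℕ) then gc l (k - j) else 0)) l]
  have hk := k.isLt
  rw [← Finset.sum_subset (Finset.range_subset_range.2 (show (k : ℕ) + 1 ≤ l by omega))]
  · apply Finset.sum_congr rfl
    intro j hj
    rw [if_pos (by simp at hj; omega)]
    congr 2
    ring
  · intro j _ hj
    rw [if_neg (by simp at hj; omega), mul_zero]

/-- Two-column shapes with columns of lengths b and a + 1. -/
theorem schur_two (l a b : ℕ) (hab : a + 1 ≤ b) (hb : a + 1 + b ≤ l) :
    schur l (fun i => (if (i : ℕ) < a + 1 then 1 else 0) + (if (i : ℕ) < b then 1 else 0)) =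
      (-1) ^ (a + 1 + b) * (gc l (a + 1) * gc l b - gc l a * gc l (b + 1)) := by
  rw [schur_FF]
  obtain ⟨b, rfl⟩ : ∃ b', b = b' + 1 := ⟨b - 1, by omega⟩
  cases a with
  | zero =>
    obtain ⟨n, rfl⟩ : ∃ n, l = n + 1 := ⟨l - 1, by omega⟩
    rw [det_one_row n ⟨b, by omega⟩]
    · simp only [Matrix.of_apply]
      have : (((((if ((0 : Fin (n + 1)) : ℕ) < 0 + 1 then 1 else 0) +
        (if ((0 : Fin (n + 1)) : ℕ) < b + 1 then 1 else 0) : ℕ) : ℤ)) -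
        (((0 : Fin (n + 1)) : ℕ) : ℤ)) = 2 := by simp
      rw [this, FF_two, hp_one, gc_zero]
      ring
    · intro i k
      simp only [Matrix.of_apply, Fin.val_succ]
      have key : ((p : Fin (n + 1)) → p.val = b → ((p.succAbove i : Fin (n + 1)) : ℕ) =
          if (i : ℕ) < b then (i : ℕ) else i + 1) := by
        intro p hp
        simp only [Fin.succAbove, Fin.lt_def, Fin.val_castSucc, hp]
        split_ifs <;> simp
      have key := key ⟨b, by omega⟩ rfl
      have : (((((if (i : ℕ) + 1 < 0 + 1 then 1 else 0) +
        (if (i : ℕ) + 1 < b + 1 then 1 else 0) : ℕ) : ℤ)) -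
        (((i : ℕ) + 1 : ℕ) : ℤ)) = -(((if (i : ℕ) < b then (i : ℕ) else i + 1) : ℕ) : ℤ) := by
        split_ifs <;> push_cast <;> omega
      rw [this, FF_neg, ← key]
      simp only [Fin.ext_iff]
  | succ a =>
    obtain ⟨n, rfl⟩ : ∃ n, l = n + 2 := ⟨l - 2, by omega⟩
    have sA : ∀ (m : ℕ) (p : Fin (m + 1)) (i : Fin m), ((p.succAbove i : Fin (m + 1)) : ℕ) =
          if (i : ℕ) < p then (i : ℕ) else i + 1 := by
      intro m p i
      simp only [Fin.succAbove, Fin.lt_def, Fin.val_castSucc]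
      split_ifs <;> simp
    obtain ⟨b, rfl⟩ : ∃ b', b = b' + 1 := ⟨b - 1, by omega⟩
    rw [det_two_row n ⟨b + 1, by omega⟩ ⟨a, by omega⟩ ⟨a, by omega⟩ ⟨b, by omega⟩]
    · simp only [Matrix.of_apply]
      have t0 : (((((if ((0 : Fin (n + 2)) : ℕ) < a + 1 + 1 then 1 else 0) +
        (if ((0 : Fin (n + 2)) : ℕ) < b + 1 + 1 then 1 else 0) : ℕ) : ℤ)) -
        (((0 : Fin (n + 2)) : ℕ) : ℤ)) = 2 := by simp
      have t1 : (((((if ((1 : Fin (n + 2)) : ℕ) < a + 1 + 1 then 1 else 0) +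
        (if ((1 : Fin (n + 2)) : ℕ) < b + 1 + 1 then 1 else 0) : ℕ) : ℤ)) -
        (((1 : Fin (n + 2)) : ℕ) : ℤ)) = 1 := by simp
      rw [t0, t1, FF_two, FF_two, FF_one, FF_one]
      ring
    · apply Fin.ext; rw [sA]; simp; omega
    · apply Fin.ext; rw [sA]; simp; omega
    · intro i; apply Fin.ext; simp only [sA]; split_ifs <;> omega
    · intro i k
      simp only [Matrix.of_apply, Fin.val_succ, Fin.ext_iff, sA]
      rw [← FF_neg]
      congr 1
      split_ifs <;> push_cast <;> omega

theorem schur_one (l b : ℕ) (hb : b ≤ l) :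
    schur l (fun i => if (i : ℕ) < b then 1 else 0) = (-1) ^ b * gc l b := by
  rw [schur_FF]
  cases b with
  | zero =>
    have : (Matrix.of fun i k : Fin l => FF l ((((if (i : ℕ) < 0 then 1 else 0) : ℕ) : ℤ)
        - (i : ℕ)) k) = 1 := by
      ext1 i k
      simp only [Matrix.of_apply, Nat.not_lt_zero, if_false, Nat.cast_zero, zero_sub, FF_neg,
        Matrix.one_apply, Fin.ext_iff, eq_comm]
    rw [this, gc_zero]; simp
  | succ b =>
    obtain ⟨n, rfl⟩ : ∃ n, l = n + 1 := ⟨l - 1, by omega⟩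
    have sA : ∀ (m : ℕ) (p : Fin (m + 1)) (i : Fin m), ((p.succAbove i : Fin (m + 1)) : ℕ) =
          if (i : ℕ) < p then (i : ℕ) else i + 1 := by
      intro m p i
      simp only [Fin.succAbove, Fin.lt_def, Fin.val_castSucc]
      split_ifs <;> simp
    rw [det_one_row n ⟨b, by omega⟩]
    · simp only [Matrix.of_apply]
      have : (((((if ((0 : Fin (n + 1)) : ℕ) < b + 1 then 1 else 0) : ℕ) : ℤ)) -
        (((0 : Fin (n + 1)) : ℕ) : ℤ)) = 1 := by simp
      rw [this, FF_one]
      ring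
    · intro i k
      simp only [Matrix.of_apply, Fin.val_succ, Fin.ext_iff, sA]
      rw [← FF_neg]
      congr 1
      split_ifs <;> push_cast <;> omega

theorem telescoped (l r : ℕ) : ∀ s : ℕ, r ≤ s → r + s ≤ l →
    (-1) ^ (r + s) * (gc l r * gc l s) =
    ∑ k ∈ Finset.range (r + 1),
      schur l (fun i => (if (i : ℕ) < r - k then 1 else 0) +
        (if (i : ℕ) < s + k then 1 else 0)) := by
  induction r with
  | zero =>
    intro s _ hl
    have := schur_one l s (by omega)
    simp [this, gc_zero]
  | succ r ih =>
    intro s hrs hl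
    rw [Finset.sum_range_succ']
    have h1 := ih (s + 1) (by omega) (by omega)
    have h2 := schur_two l r s hrs hl
    simp only [Nat.add_sub_add_right, Nat.sub_zero, Nat.add_zero, h2]
    simp only [show ∀ k, s + 1 + k = s + (k + 1) from fun k => by omega] at h1
    rw [← h1]
    ring

/-- For `0 ≤ r ≤ s` (in at least `r + s` variables, so that the identity
of symmetric functions is faithfully represented),
`e_r · e_s = s_{Λ^r} · s_{Λ^s} = Σ_{k=0}^{r} s_{Λ^{r-k} + Λ^{s+k}}`. -/
theorem elementary_product_pieri (l r s : ℕ) (hrs : r ≤ s) (hl : r + s ≤ l) :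
    schur l (fun i => if (i : ℕ) < r then 1 else 0) *
      schur l (fun i => if (i : ℕ) < s then 1 else 0) =
    ∑ k ∈ Finset.range (r + 1),
      schur l (fun i => (if (i : ℕ) < r - k then 1 else 0) +
        (if (i : ℕ) < s + k then 1 else 0)) := by
  rw [← telescoped l r s hrs hl, schur_one l r (by omega), schur_one l s (by omega)]
  ring
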